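/- Let $d \ge 3$, $\kappa \in (2,d)$, let $R : \mathbb{R}^d \to [0,\infty)$ satisfy $R(x) \le C(1+|x|)^{-\kappa}$, and let $P$ be the heat kernel. For $t > 0$, $x \in \mathbb{R}^d$, set $H_{t,x}(r,z) = P_{r(t-r)/t}(z + \tfrac{r}{t}x) - P_r(z) - P_{t-r}(z+x)$ for $0 < r < t$. Then, with $\tilde\mu = 1 - 2/\kappa$, there is a constant $C'$ such that for all $t > 0$ and $x \in \mathbb{R}^d$, $\int_0^t \int_{\mathbb{R}^{2d}} |H_{t,x}(r,z_1)||H_{t,x}(r,z_2)| R(z_1 - z_2)\,dz_1\,dz_2\,dr \le C' (1+t)^{-\tilde\mu}\big(1 + (1+t)^{-1}|x|^2\big)$. -/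

import Mathlib

open MeasureTheory Real Set

noncomputable def heatKernel (d : ℕ) (t : ℝ) (x : EuclideanSpace ℝ (Fin d)) : ℝ :=
  (2 * Real.pi * t) ^ (-(d : ℝ) / 2) * Real.exp (-‖x‖ ^ 2 / (2 * t))

/-- `H_{t,x}(r,z)`: difference between the Brownian bridge kernel and the two
free heat kernels anchored at the endpoints. -/
noncomputable def Hker (d : ℕ) (t : ℝ) (x : EuclideanSpace ℝ (Fin d)) (r : ℝ)
    (z : EuclideanSpace ℝ (Fin d)) : ℝ :=
  heatKernel d (r * (t - r) / t) (z + (r / t) • x) - heatKernel d r z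
    - heatKernel d (t - r) (z + x)

lemma hk_nonneg (d : ℕ) {s : ℝ} (hs : 0 < s) (z : EuclideanSpace ℝ (Fin d)) :
    0 ≤ heatKernel d s z := by
  unfold heatKernel; positivity

lemma hk_neg (d : ℕ) (s : ℝ) (z : EuclideanSpace ℝ (Fin d)) :
    heatKernel d s (-z) = heatKernel d s z := by
  unfold heatKernel; rw [norm_neg]

lemma hk_cont (d : ℕ) (s : ℝ) : Continuous (heatKernel d s) := by
  unfold heatKernel; fun_prop

lemma hk_le (d : ℕ) {s : ℝ} (hs : 0 < s) (z : EuclideanSpace ℝ (Fin d)) :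
    heatKernel d s z ≤ (2 * Real.pi * s) ^ (-(d : ℝ) / 2) := by
  unfold heatKernel
  have h1 : Real.exp (-‖z‖ ^ 2 / (2 * s)) ≤ 1 := by
    rw [Real.exp_le_one_iff]
    apply div_nonpos_of_nonpos_of_nonneg
    · nlinarith [sq_nonneg ‖z‖]
    · positivity
  exact mul_le_of_le_one_right (by positivity) h1

lemma gauss_integrable (d : ℕ) {b : ℝ} (hb : 0 < b) :
    Integrable (fun v : EuclideanSpace ℝ (Fin d) => Real.exp (-b * ‖v‖ ^ 2)) := by
  by_contra h
  have h1 := GaussianFourier.integral_rexp_neg_mul_sq_norm (V := EuclideanSpace ℝ (Fin d)) hb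
  rw [integral_undef h] at h1
  have : 0 < (Real.pi / b) ^ (Module.finrank ℝ (EuclideanSpace ℝ (Fin d)) / 2 : ℝ) := by
    have := Real.pi_pos
    positivity
  linarith

lemma hk_eq (d : ℕ) (s : ℝ) : heatKernel d s = fun z =>
    (2 * Real.pi * s) ^ (-(d : ℝ) / 2) * Real.exp (-(1 / (2 * s)) * ‖z‖ ^ 2) := by
  funext z
  unfold heatKernel
  congr 2
  ring

lemma hk_integrable (d : ℕ) {s : ℝ} (hs : 0 < s) : Integrable (heatKernel d s) := by
  rw [hk_eq]
  exact (gauss_integrable d (by positivity)).const_mul _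

lemma hk_integral (d : ℕ) {s : ℝ} (hs : 0 < s) : ∫ z, heatKernel d s z = 1 := by
  rw [hk_eq, integral_const_mul, GaussianFourier.integral_rexp_neg_mul_sq_norm (by positivity)]
  have hpi := Real.pi_pos
  have : Real.pi / (1 / (2 * s)) = 2 * Real.pi * s := by field_simp
  rw [this, finrank_euclideanSpace_fin, ← Real.rpow_add (by positivity)]
  have : -(d : ℝ) / 2 + d / 2 = 0 := by ring
  rw [this, Real.rpow_zero]

lemma hk_lint (d : ℕ) {s : ℝ} (hs : 0 < s) (m : EuclideanSpace ℝ (Fin d)) :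
    ∫⁻ z, ENNReal.ofReal (heatKernel d s (z + m)) = 1 := by
  rw [← ofReal_integral_eq_lintegral_ofReal ((hk_integrable d hs).comp_add_right m)
    (Filter.Eventually.of_forall fun z => hk_nonneg d hs _),
    integral_add_right_eq_self, hk_integral d hs, ENNReal.ofReal_one]

/-- radial integral -/
lemma radial_bound (d : ℕ) (hd : 3 ≤ d) (κ : ℝ) (hκ : 2 < κ ∧ κ < d) :
    ∃ K : ℝ, 0 < K ∧ ∀ a : ℝ, 0 < a →
      ∫⁻ z : EuclideanSpace ℝ (Fin d),
        ENNReal.ofReal ((Iio a).indicator (fun y : ℝ => (1 + y) ^ (-κ)) ‖z‖)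
        ≤ ENNReal.ofReal (K * a ^ ((d : ℝ) - κ)) := by
  have : Nontrivial (EuclideanSpace ℝ (Fin d)) := by
    have : 0 < Module.finrank ℝ (EuclideanSpace ℝ (Fin d)) := by
      rw [finrank_euclideanSpace_fin]; omega
    exact Module.nontrivial_of_finrank_pos this
  set V := (volume : Measure (EuclideanSpace ℝ (Fin d))).real (Metric.ball 0 1) with hV
  refine ⟨d * V * (1 / (d - κ)) + 1, ?_, ?_⟩
  · have : 0 < (d : ℝ) - κ := by linarith [hκ.2]
    positivity
  intro a ha
  have hdk : 0 < (d : ℝ) - κ := by linarith [hκ.2]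
  set f : ℝ → ℝ := (Iio a).indicator (fun y : ℝ => (1 + y) ^ (-κ)) with hf
  have hdom : IntegrableOn (fun y : ℝ => y ^ ((d : ℝ) - 1 - κ)) (Ioo 0 a) := by
    have := intervalIntegral.intervalIntegrable_rpow' (a := 0) (b := a)
      (r := (d : ℝ) - 1 - κ) (by linarith)
    rw [intervalIntegrable_iff_integrableOn_Ioo_of_le ha.le] at this
    exact this
  have hdomI : Integrable ((Ioo 0 a).indicator (fun y : ℝ => y ^ ((d : ℝ) - 1 - κ)))
      (volume.restrict (Ioi 0)) := by
    apply Integrable.restrict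
    rwa [integrable_indicator_iff measurableSet_Ioo]
  have hmeasf : Measurable f := by
    apply Measurable.indicator _ measurableSet_Iio
    fun_prop
  have hle : ∀ y ∈ Ioi (0 : ℝ), 0 ≤ y ^ (d - 1) • f y ∧ y ^ (d - 1) • f y ≤
      (Ioo 0 a).indicator (fun y : ℝ => y ^ ((d : ℝ) - 1 - κ)) y := by
    intro y hy
    have hy0 : 0 < y := hy
    by_cases hya : y < a
    · have h1 : f y = (1 + y) ^ (-κ) := by simp [hf, hya]
      rw [h1, indicator_of_mem (show y ∈ Ioo 0 a from ⟨hy0, hya⟩), smul_eq_mul]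
      refine ⟨by positivity, ?_⟩
      have h2 : (1 + y) ^ (-κ) ≤ y ^ (-κ) :=
        Real.rpow_le_rpow_of_nonpos hy0 (by linarith) (by linarith [hκ.1])
      have h3 : y ^ ((d : ℝ) - 1 - κ) = y ^ (d - 1) * y ^ (-κ) := by
        rw [← Real.rpow_natCast, ← Real.rpow_add hy0]
        congr 1
        rw [Nat.cast_sub (by omega)]
        push_cast; ring
      rw [h3]
      gcongr
    · have h1 : f y = 0 := by simp [hf, hya]
      rw [h1, indicator_of_notMem (fun h => hya h.2)]
      simp
  have hint : IntegrableOn (fun y : ℝ => y ^ (d - 1) • f y) (Ioi 0) := by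
    refine Integrable.mono' hdomI (by fun_prop) ?_
    filter_upwards [ae_restrict_mem measurableSet_Ioi] with y hy
    rw [Real.norm_of_nonneg (hle y hy).1]
    exact (hle y hy).2
  have hint2 : Integrable (fun z : EuclideanSpace ℝ (Fin d) => f ‖z‖) := by
    have := (integrable_fun_norm_addHaar
      (volume : Measure (EuclideanSpace ℝ (Fin d))) (f := f)).2
    rw [finrank_euclideanSpace_fin] at this
    exact this hint
  have hf0 : ∀ z : EuclideanSpace ℝ (Fin d), 0 ≤ f ‖z‖ := by
    intro z
    rw [hf, indicator_apply]
    split_ifs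
    · positivity
    · exact le_rfl
  rw [← ofReal_integral_eq_lintegral_ofReal hint2 (Filter.Eventually.of_forall hf0)]
  apply ENNReal.ofReal_le_ofReal
  have h4 := integral_fun_norm_addHaar (volume : Measure (EuclideanSpace ℝ (Fin d))) f
  rw [finrank_euclideanSpace_fin] at h4
  rw [h4, nsmul_eq_mul, smul_eq_mul]
  have h5 : ∫ y in Ioi (0 : ℝ), y ^ (d - 1) • f y ≤ a ^ ((d : ℝ) - κ) / (d - κ) := by
    calc _ ≤ ∫ y in Ioi (0 : ℝ), (Ioo 0 a).indicator (fun y : ℝ => y ^ ((d : ℝ) - 1 - κ)) y := by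
          apply setIntegral_mono_on hint hdomI measurableSet_Ioi
          exact fun y hy => (hle y hy).2
      _ = ∫ y in (0 : ℝ)..a, y ^ ((d : ℝ) - 1 - κ) := by
          rw [setIntegral_indicator measurableSet_Ioo, intervalIntegral.integral_of_le ha.le,
            integral_Ioc_eq_integral_Ioo]
          congr 2
          ext y; simp
      _ = _ := by
          rw [integral_rpow (Or.inl (by linarith))]
          have : (d : ℝ) - 1 - κ + 1 = d - κ := by ring
          rw [this, Real.zero_rpow hdk.ne', sub_zero]
  have hV0 : 0 ≤ V := by positivity
  have hp : 0 < a ^ ((d : ℝ) - κ) := by positivity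
  calc (d : ℝ) * (V * ∫ y in Ioi (0 : ℝ), y ^ (d - 1) • f y)
      ≤ d * (V * (a ^ ((d : ℝ) - κ) / (d - κ))) := by gcongr
    _ = d * V * (1 / (d - κ)) * a ^ ((d : ℝ) - κ) := by ring
    _ ≤ _ := by gcongr; linarith

lemma conv_bound (d : ℕ) (hd : 3 ≤ d) (κ : ℝ) (hκ : 2 < κ ∧ κ < d) :
    ∃ K : ℝ, 0 < K ∧ ∀ s : ℝ, 0 < s → ∀ m z₁ : EuclideanSpace ℝ (Fin d),
      ∫⁻ z₂, ENNReal.ofReal (heatKernel d s (z₂ + m)) *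
        ENNReal.ofReal ((1 + ‖z₁ - z₂‖) ^ (-κ)) ≤ ENNReal.ofReal (K * (1 + s) ^ (-κ / 2)) := by
  obtain ⟨K, hK, hrad⟩ := radial_bound d hd κ hκ
  have hκ0 : 0 < κ := by linarith [hκ.1]
  refine ⟨(K + 1) * 2 ^ (κ / 2), by positivity, ?_⟩
  intro s hs m z₁
  have hρ1 : ∀ w : EuclideanSpace ℝ (Fin d), (1 + ‖w‖) ^ (-κ) ≤ 1 := fun w =>
    Real.rpow_le_one_of_one_le_of_nonpos (by linarith [norm_nonneg w]) (by linarith)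
  have htwo : (2 : ℝ) ^ (κ / 2) * 2 ^ (-κ / 2) = 1 := by
    rw [← Real.rpow_add (by norm_num)]
    simp [neg_div]
  rcases le_total s 1 with h1 | h1
  · calc _ ≤ ∫⁻ z₂, ENNReal.ofReal (heatKernel d s (z₂ + m)) := by
          apply lintegral_mono
          intro z
          refine mul_le_of_le_one_right zero_le ?_
          rw [ENNReal.ofReal_le_one]
          exact hρ1 _
      _ = ENNReal.ofReal 1 := by rw [hk_lint d hs, ENNReal.ofReal_one]
      _ ≤ _ := by
          apply ENNReal.ofReal_le_ofReal
          have h2 : (2 : ℝ) ^ (-κ / 2) ≤ (1 + s) ^ (-κ / 2) :=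
            Real.rpow_le_rpow_of_nonpos (by linarith) (by linarith) (by linarith)
          have h3 : (0 : ℝ) < 2 ^ (κ / 2) := by positivity
          calc (1 : ℝ) = 1 * 2 ^ (κ / 2) * 2 ^ (-κ / 2) := by rw [one_mul, htwo]
            _ ≤ _ := by gcongr; linarith
  · have hpi := Real.pi_gt_three
    have hss : 0 < √s := Real.sqrt_pos.2 hs
    have hspow : ∀ p : ℝ, (√s) ^ p = s ^ (p / 2) := by
      intro p
      rw [Real.sqrt_eq_rpow, ← Real.rpow_mul hs.le]
      congr 1; ring
    have hpt : ∀ z₂ : EuclideanSpace ℝ (Fin d), ENNReal.ofReal (heatKernel d s (z₂ + m)) *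
        ENNReal.ofReal ((1 + ‖z₁ - z₂‖) ^ (-κ)) ≤
        ENNReal.ofReal (s ^ (-(d : ℝ) / 2)) *
          ENNReal.ofReal ((Iio (√s)).indicator (fun y : ℝ => (1 + y) ^ (-κ)) ‖z₂ - z₁‖)
        + ENNReal.ofReal (s ^ (-κ / 2)) * ENNReal.ofReal (heatKernel d s (z₂ + m)) := by
      intro z₂
      rw [norm_sub_rev z₂ z₁]
      by_cases h : ‖z₁ - z₂‖ < √s
      · refine le_trans ?_ le_self_add
        rw [indicator_of_mem (show ‖z₁ - z₂‖ ∈ Iio √s from h)]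
        gcongr
        refine (hk_le d hs _).trans ?_
        apply Real.rpow_le_rpow_of_nonpos hs
        · nlinarith
        · have : (0 : ℝ) ≤ d := by positivity
          linarith
      · refine le_trans ?_ le_add_self
        rw [mul_comm]
        gcongr
        push Not at h
        rw [← hspow]
        exact Real.rpow_le_rpow_of_nonpos hss (by linarith) (by linarith)
    have hsm : s ^ (-κ / 2) ≤ 2 ^ (κ / 2) * (1 + s) ^ (-κ / 2) := by
      have h2 : (2 * s) ^ (-κ / 2) ≤ (1 + s) ^ (-κ / 2) :=
        Real.rpow_le_rpow_of_nonpos (by linarith) (by linarith) (by linarith)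
      rw [Real.mul_rpow (by norm_num) hs.le] at h2
      calc s ^ (-κ / 2) = 2 ^ (κ / 2) * (2 ^ (-κ / 2) * s ^ (-κ / 2)) := by
            rw [← mul_assoc, htwo, one_mul]
        _ ≤ _ := by gcongr
    have hm1 : Measurable (fun z₂ : EuclideanSpace ℝ (Fin d) =>
        ENNReal.ofReal ((Iio (√s)).indicator (fun y : ℝ => (1 + y) ^ (-κ)) ‖z₂ - z₁‖)) := by
      apply Measurable.ennreal_ofReal
      have : Measurable ((Iio (√s)).indicator (fun y : ℝ => (1 + y) ^ (-κ))) := by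
        apply Measurable.indicator _ measurableSet_Iio
        fun_prop
      exact this.comp (by fun_prop)
    have hm2 : Measurable (fun z₂ : EuclideanSpace ℝ (Fin d) =>
        ENNReal.ofReal (heatKernel d s (z₂ + m))) := by
      have := hk_cont d s
      apply Measurable.ennreal_ofReal
      exact Continuous.measurable (by fun_prop)
    calc _ ≤ _ := lintegral_mono hpt
      _ = ENNReal.ofReal (s ^ (-(d : ℝ) / 2)) * (∫⁻ z : EuclideanSpace ℝ (Fin d),
            ENNReal.ofReal ((Iio (√s)).indicator (fun y : ℝ => (1 + y) ^ (-κ)) ‖z‖))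
          + ENNReal.ofReal (s ^ (-κ / 2)) * 1 := by
          rw [lintegral_add_left (hm1.const_mul _), lintegral_const_mul _ hm1,
            lintegral_const_mul _ hm2, hk_lint d hs,
            lintegral_sub_right_eq_self (fun z : EuclideanSpace ℝ (Fin d) =>
            ENNReal.ofReal ((Iio (√s)).indicator (fun y : ℝ => (1 + y) ^ (-κ)) ‖z‖)) z₁]
      _ ≤ ENNReal.ofReal (s ^ (-(d : ℝ) / 2)) * ENNReal.ofReal (K * (√s) ^ ((d : ℝ) - κ))
          + ENNReal.ofReal (s ^ (-κ / 2)) := by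
          rw [mul_one]
          gcongr
          exact hrad _ hss
      _ = ENNReal.ofReal ((K + 1) * s ^ (-κ / 2)) := by
          rw [hspow, ← ENNReal.ofReal_mul (by positivity), ← ENNReal.ofReal_add (by positivity)
            (by positivity)]
          congr 1
          have : s ^ (-κ / 2) = s ^ (-(d : ℝ) / 2) * s ^ (((d : ℝ) - κ) / 2) := by
            rw [← Real.rpow_add hs]; congr 1; ring
          rw [this]; ring
      _ ≤ _ := by
          apply ENNReal.ofReal_le_ofReal
          rw [mul_assoc]
          gcongr

lemma hell (d : ℕ) {s r : ℝ} (hs : 0 < s) (hr : 0 < r) (y : EuclideanSpace ℝ (Fin d)) :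
    ∫⁻ z, ENNReal.ofReal ((√(heatKernel d s (z + y)) - √(heatKernel d r z)) ^ 2) =
      ENNReal.ofReal (2 * (1 - (4 * s * r / (s + r) ^ 2) ^ ((d : ℝ) / 4)
        * Real.exp (-‖y‖ ^ 2 / (4 * (s + r))))) := by
  have hpi := Real.pi_pos
  set b : ℝ := (s + r) / (4 * s * r) with hb
  have hb0 : 0 < b := by positivity
  set c : ℝ := r / (s + r) with hc
  set q : ℝ := ((2 * Real.pi * s) * (2 * Real.pi * r)) ^ (-(d : ℝ) / 4) with hq
  set e : ℝ := Real.exp (-‖y‖ ^ 2 / (4 * (s + r))) with he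
  have hg : ∀ z : EuclideanSpace ℝ (Fin d),
      √(heatKernel d s (z + y)) * √(heatKernel d r z) =
        q * e * Real.exp (-b * ‖z + c • y‖ ^ 2) := by
    intro z
    rw [← Real.sqrt_mul (hk_nonneg d hs _)]
    have : heatKernel d s (z + y) * heatKernel d r z =
        (q * e * Real.exp (-b * ‖z + c • y‖ ^ 2)) ^ 2 := by
      have h1 : q ^ 2 = (2 * Real.pi * s) ^ (-(d : ℝ) / 2) * (2 * Real.pi * r) ^ (-(d : ℝ) / 2) := by
        rw [hq, ← Real.rpow_natCast, ← Real.rpow_mul (by positivity),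
          ← Real.mul_rpow (by positivity) (by positivity)]
        congr 1
        push_cast; ring
      have h2 : (e * Real.exp (-b * ‖z + c • y‖ ^ 2)) ^ 2 =
          Real.exp (-‖z + y‖ ^ 2 / (2 * s)) * Real.exp (-‖z‖ ^ 2 / (2 * r)) := by
        rw [he, ← Real.exp_add, ← Real.exp_add, ← Real.exp_nat_mul]
        congr 1
        rw [norm_add_sq_real, norm_add_sq_real, norm_smul, inner_smul_right, mul_pow,
          Real.norm_eq_abs, sq_abs, hb, hc]
        have : s + r ≠ 0 := by positivity
        field_simp
        ring
      unfold heatKernel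
      rw [mul_assoc q, mul_pow q, h1, h2]
      ring
    rw [this, Real.sqrt_sq (by positivity)]
  have hgi : Integrable (fun z : EuclideanSpace ℝ (Fin d) =>
      q * e * Real.exp (-b * ‖z + c • y‖ ^ 2)) :=
    ((gauss_integrable d hb0).comp_add_right (c • y)).const_mul _
  have hgint : ∫ z : EuclideanSpace ℝ (Fin d), q * e * Real.exp (-b * ‖z + c • y‖ ^ 2) =
      (4 * s * r / (s + r) ^ 2) ^ ((d : ℝ) / 4) * e := by
    rw [integral_const_mul,
      integral_add_right_eq_self (fun z : EuclideanSpace ℝ (Fin d) => Real.exp (-b * ‖z‖ ^ 2)),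
      GaussianFourier.integral_rexp_neg_mul_sq_norm hb0, finrank_euclideanSpace_fin]
    have h1 : (Real.pi / b) ^ ((d : ℝ) / 2) = ((Real.pi / b) ^ 2) ^ ((d : ℝ) / 4) := by
      rw [← Real.rpow_natCast (Real.pi / b), ← Real.rpow_mul (by positivity)]
      congr 1
      push_cast; ring
    have h2 : q = ((2 * Real.pi * s * (2 * Real.pi * r))⁻¹) ^ ((d : ℝ) / 4) := by
      rw [hq, Real.inv_rpow (by positivity), ← Real.rpow_neg (by positivity)]
      congr 1
      ring
    rw [h1, h2, mul_right_comm, ← Real.mul_rpow (by positivity) (by positivity)]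
    congr 2
    rw [hb]
    field_simp
    ring
  have hpt : ∀ z : EuclideanSpace ℝ (Fin d),
      (√(heatKernel d s (z + y)) - √(heatKernel d r z)) ^ 2 =
      heatKernel d s (z + y) + heatKernel d r z -
        2 * (q * e * Real.exp (-b * ‖z + c • y‖ ^ 2)) := by
    intro z
    rw [← hg z]
    have h1 := Real.sq_sqrt (hk_nonneg d hs (z + y))
    have h2 := Real.sq_sqrt (hk_nonneg d hr z)
    nlinarith
  have hi1 := (hk_integrable d hs).comp_add_right y
  have hi2 := hk_integrable d hr
  have hint : Integrable (fun z : EuclideanSpace ℝ (Fin d) =>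
      (√(heatKernel d s (z + y)) - √(heatKernel d r z)) ^ 2) := by
    simp_rw [hpt]
    exact (hi1.add hi2).sub (hgi.const_mul 2)
  rw [← ofReal_integral_eq_lintegral_ofReal hint
    (Filter.Eventually.of_forall fun z => sq_nonneg _)]
  congr 1
  simp_rw [hpt]
  have e1 : ∫ z : EuclideanSpace ℝ (Fin d), (heatKernel d s (z + y) + heatKernel d r z -
        2 * (q * e * Real.exp (-b * ‖z + c • y‖ ^ 2))) =
      (∫ z : EuclideanSpace ℝ (Fin d), (heatKernel d s (z + y) + heatKernel d r z)) -
      ∫ z : EuclideanSpace ℝ (Fin d), 2 * (q * e * Real.exp (-b * ‖z + c • y‖ ^ 2)) :=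
    integral_sub (hi1.add hi2) (hgi.const_mul 2)
  rw [e1, integral_add hi1 hi2, integral_add_right_eq_self, hk_integral d hs, hk_integral d hr,
    integral_const_mul, hgint]
  ring

/-- Hellinger estimate for the bridge against the free kernel. -/
lemma hell_bridge (d : ℕ) (hd : 3 ≤ d) {t r : ℝ} (hr : 0 < r) (hrt : r ≤ t / 2)
    (x : EuclideanSpace ℝ (Fin d)) :
    ∫⁻ z, ENNReal.ofReal ((√(heatKernel d (r * (t - r) / t) (z + (r / t) • x))
        - √(heatKernel d r z)) ^ 2) ≤
      ENNReal.ofReal (2 * d * (r / t * (1 + ‖x‖ ^ 2 / t))) := by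
  have ht : 0 < t := by linarith
  have htr : 0 < t - r := by linarith
  have hs : 0 < r * (t - r) / t := by positivity
  rw [hell d hs hr]
  apply ENNReal.ofReal_le_ofReal
  set s := r * (t - r) / t with hsdef
  set u := 4 * s * r / (s + r) ^ 2 with hu
  set v := ‖(r / t) • x‖ ^ 2 / (4 * (s + r)) with hv
  have hu0 : 0 < u := by positivity
  have hu1 : u ≤ 1 := by
    rw [hu, div_le_one (by positivity)]
    nlinarith [sq_nonneg (s - r)]
  have hu2 : 1 - r / t ≤ u := by
    have h1 : u = 4 * (1 - r / t) / (2 - r / t) ^ 2 := by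
      have : 2 * t - r ≠ 0 := by linarith
      have : s + r ≠ 0 := by positivity
      have h3 : s + r = r * (2 - r / t) := by rw [hsdef]; field_simp; ring
      have h4 : s = r * (1 - r / t) := by rw [hsdef]; field_simp
      rw [hu, h3, h4, mul_pow]
      field_simp
    have h2 : 0 < r / t := by positivity
    have h3 : r / t ≤ 1 / 2 := by rw [div_le_iff₀ ht]; linarith
    rw [h1, le_div_iff₀ (by nlinarith), mul_comm]
    apply mul_le_mul_of_nonneg_right
    · nlinarith
    · linarith
  have hpow : 1 - d * (r / t) ≤ u ^ ((d : ℝ) / 4) := by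
    have hb : 1 + (d : ℝ) * (u - 1) ≤ (1 + (u - 1)) ^ d :=
      one_add_mul_le_pow (by linarith) d
    have h1 : u ^ d ≤ u ^ ((d : ℝ) / 4) := by
      rw [← Real.rpow_natCast]
      apply Real.rpow_le_rpow_of_exponent_ge hu0 hu1
      have : (0 : ℝ) ≤ d := by positivity
      linarith
    have h2 : (1 + (u - 1)) = u := by ring
    rw [h2] at hb
    have : (d : ℝ) * (1 - r / t) ≤ d * u := by gcongr
    linarith
  have hpow1 : u ^ ((d : ℝ) / 4) ≤ 1 := Real.rpow_le_one hu0.le hu1 (by positivity)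
  have hexp : 1 - v ≤ Real.exp (-‖(r / t) • x‖ ^ 2 / (4 * (s + r))) := by
    have := Real.add_one_le_exp (-v)
    rw [neg_div]
    linarith
  have hv1 : v ≤ r / t * (‖x‖ ^ 2 / t) := by
    rw [hv, norm_smul, mul_pow, Real.norm_eq_abs, sq_abs]
    calc (r / t) ^ 2 * ‖x‖ ^ 2 / (4 * (s + r)) ≤ (r / t) ^ 2 * ‖x‖ ^ 2 / r := by
          gcongr; linarith
      _ = _ := by field_simp
  have hv0 : 0 ≤ v := by positivity
  set w := Real.exp (-‖(r / t) • x‖ ^ 2 / (4 * (s + r))) with hw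
  have hw1 : w ≤ 1 := by
    rw [hw, Real.exp_le_one_iff, neg_div]
    linarith
  have hd1 : (3 : ℝ) ≤ d := by exact_mod_cast hd
  have hfin : 1 - u ^ ((d : ℝ) / 4) * w ≤ d * (r / t) + v := by
    have hp0 : 0 ≤ u ^ ((d : ℝ) / 4) := by positivity
    nlinarith
  have h6 : 0 ≤ r / t * (‖x‖ ^ 2 / t) := by positivity
  nlinarith

lemma J_le {E : Type*} [MeasurableSpace E] (μ : Measure E) (ρ : E → E → ENNReal)
    (f g : E → ENNReal) (hf : Measurable f) (hg : Measurable g)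
    (hρ : Measurable (Function.uncurry ρ)) (M : ENNReal)
    (hM : ∀ z₁, ∫⁻ z₂, g z₂ * ρ z₁ z₂ ∂μ ≤ M) :
    ∫⁻ z₁, ∫⁻ z₂, f z₁ * g z₂ * ρ z₁ z₂ ∂μ ∂μ ≤ (∫⁻ z, f z ∂μ) * M := by
  rw [← lintegral_mul_const _ hf]
  apply lintegral_mono
  intro z₁
  simp only [mul_assoc]
  have : Measurable (fun z₂ => g z₂ * ρ z₁ z₂) :=
    hg.mul (hρ.comp (measurable_const.prodMk measurable_id))
  rw [lintegral_const_mul _ this]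
  gcongr
  exact hM z₁

lemma J_swap {E : Type*} [MeasurableSpace E] (μ : Measure E) [SFinite μ] (ρ : E → E → ENNReal)
    (f g : E → ENNReal) (hf : Measurable f) (hg : Measurable g)
    (hρ : Measurable (Function.uncurry ρ)) (hsym : ∀ a b, ρ a b = ρ b a) :
    ∫⁻ z₁, ∫⁻ z₂, f z₁ * g z₂ * ρ z₁ z₂ ∂μ ∂μ =
    ∫⁻ z₁, ∫⁻ z₂, g z₁ * f z₂ * ρ z₁ z₂ ∂μ ∂μ := by
  rw [lintegral_lintegral_swap]
  · simp_rw [fun a b => hsym b a, fun a b => mul_comm (f b) (g a)]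
  · exact (((hf.comp measurable_fst).mul (hg.comp measurable_snd)).mul hρ).aemeasurable

lemma quad_bound {E : Type*} [MeasurableSpace E] (μ : Measure E) [SFinite μ]
    (ρ : E → E → ENNReal) (a S e : E → ENNReal) (ha : Measurable a) (hS : Measurable S)
    (he : Measurable e)
    (hρ : Measurable (Function.uncurry ρ)) (hsym : ∀ a b, ρ a b = ρ b a) (MS Me : ENNReal)
    (hMS : ∀ z₁, ∫⁻ z₂, S z₂ * ρ z₁ z₂ ∂μ ≤ MS) (hMe : ∀ z₁, ∫⁻ z₂, e z₂ * ρ z₁ z₂ ∂μ ≤ Me) :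
    ∫⁻ z₁, ∫⁻ z₂, (a z₁ * S z₂ + S z₁ * a z₂ + (S z₁ + e z₁) * e z₂ + e z₁ * S z₂)
      * ρ z₁ z₂ ∂μ ∂μ ≤
    (∫⁻ z, a z ∂μ) * MS + (∫⁻ z, a z ∂μ) * MS + ((∫⁻ z, S z ∂μ) + (∫⁻ z, e z ∂μ)) * Me
      + (∫⁻ z, S z ∂μ) * Me := by
  have hm2 : ∀ f g : E → ENNReal, Measurable f → Measurable g →
      Measurable (Function.uncurry fun z₁ z₂ => f z₁ * g z₂ * ρ z₁ z₂) := fun f g hf hg =>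
    ((hf.comp measurable_fst).mul (hg.comp measurable_snd)).mul hρ
  have hm1 : ∀ f g : E → ENNReal, Measurable f → Measurable g → ∀ z₁,
      Measurable (fun z₂ => f z₁ * g z₂ * ρ z₁ z₂) := fun f g hf hg z₁ =>
    (hm2 f g hf hg).comp (measurable_const.prodMk measurable_id)
  have hm3 : ∀ f g : E → ENNReal, Measurable f → Measurable g →
      Measurable (fun z₁ => ∫⁻ z₂, f z₁ * g z₂ * ρ z₁ z₂ ∂μ) := fun f g hf hg =>
    (hm2 f g hf hg).lintegral_prod_right
  have hSe : Measurable (fun z => S z + e z) := hS.add he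
  have hsplit : ∫⁻ z₁, ∫⁻ z₂, (a z₁ * S z₂ + S z₁ * a z₂ + (S z₁ + e z₁) * e z₂ + e z₁ * S z₂)
      * ρ z₁ z₂ ∂μ ∂μ =
      (∫⁻ z₁, ∫⁻ z₂, a z₁ * S z₂ * ρ z₁ z₂ ∂μ ∂μ) + (∫⁻ z₁, ∫⁻ z₂, S z₁ * a z₂ * ρ z₁ z₂ ∂μ ∂μ)
      + (∫⁻ z₁, ∫⁻ z₂, (S z₁ + e z₁) * e z₂ * ρ z₁ z₂ ∂μ ∂μ)
      + (∫⁻ z₁, ∫⁻ z₂, e z₁ * S z₂ * ρ z₁ z₂ ∂μ ∂μ) := by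
    rw [← lintegral_add_left (hm3 a S ha hS),
      ← lintegral_add_right _ (hm3 (fun z => S z + e z) e hSe he),
      ← lintegral_add_right _ (hm3 e S he hS)]
    congr 1
    funext z₁
    rw [← lintegral_add_left (hm1 a S ha hS z₁),
      ← lintegral_add_right _ (hm1 (fun z => S z + e z) e hSe he z₁),
      ← lintegral_add_right _ (hm1 e S he hS z₁)]
    congr 1
    funext z₂
    ring
  rw [hsplit, J_swap μ ρ S a hS ha hρ hsym, J_swap μ ρ e S he hS hρ hsym, ← lintegral_add_left hS]
  gcongr
  · exact J_le μ ρ a S ha hS hρ MS hMS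
  · exact J_le μ ρ a S ha hS hρ MS hMS
  · exact J_le μ ρ (fun z => S z + e z) e hSe he hρ Me hMe
  · exact J_le μ ρ S e hS he hρ Me hMe

lemma pw_bound {A₁ B₁ E₁ A₂ B₂ E₂ : ℝ} (hA₁ : 0 ≤ A₁) (hB₁ : 0 ≤ B₁) (hE₁ : 0 ≤ E₁)
    (hA₂ : 0 ≤ A₂) (hB₂ : 0 ≤ B₂) (hE₂ : 0 ≤ E₂) :
    |A₁ - B₁ - E₁| * |A₂ - B₂ - E₂| ≤
      (√A₁ - √B₁) ^ 2 * (A₂ + B₂) + (A₁ + B₁) * (√A₂ - √B₂) ^ 2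
        + (A₁ + B₁ + E₁) * E₂ + E₁ * (A₂ + B₂) := by
  obtain ⟨a, ha, rfl⟩ : ∃ a, 0 ≤ a ∧ A₁ = a ^ 2 := ⟨√A₁, Real.sqrt_nonneg _, (Real.sq_sqrt hA₁).symm⟩
  obtain ⟨b, hb, rfl⟩ : ∃ a, 0 ≤ a ∧ B₁ = a ^ 2 := ⟨√B₁, Real.sqrt_nonneg _, (Real.sq_sqrt hB₁).symm⟩
  obtain ⟨u, hu, rfl⟩ : ∃ a, 0 ≤ a ∧ A₂ = a ^ 2 := ⟨√A₂, Real.sqrt_nonneg _, (Real.sq_sqrt hA₂).symm⟩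
  obtain ⟨v, hv, rfl⟩ : ∃ a, 0 ≤ a ∧ B₂ = a ^ 2 := ⟨√B₂, Real.sqrt_nonneg _, (Real.sq_sqrt hB₂).symm⟩
  rw [Real.sqrt_sq ha, Real.sqrt_sq hb, Real.sqrt_sq hu, Real.sqrt_sq hv]
  have h1 : |a ^ 2 - b ^ 2 - E₁| ≤ |a ^ 2 - b ^ 2| + E₁ := by
    have := abs_sub (a ^ 2 - b ^ 2) E₁
    rwa [abs_of_nonneg hE₁] at this
  have h2 : |u ^ 2 - v ^ 2 - E₂| ≤ |u ^ 2 - v ^ 2| + E₂ := by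
    have := abs_sub (u ^ 2 - v ^ 2) E₂
    rwa [abs_of_nonneg hE₂] at this
  have h3 : |a ^ 2 - b ^ 2| ≤ a ^ 2 + b ^ 2 := by
    rw [abs_le]; constructor <;> nlinarith
  have h4 : |u ^ 2 - v ^ 2| ≤ u ^ 2 + v ^ 2 := by
    rw [abs_le]; constructor <;> nlinarith
  have h5 : |a ^ 2 - b ^ 2| * |u ^ 2 - v ^ 2| ≤
      (a - b) ^ 2 * (u ^ 2 + v ^ 2) + (a ^ 2 + b ^ 2) * (u - v) ^ 2 := by
    rw [← abs_mul]
    have e1 : (a ^ 2 - b ^ 2) * (u ^ 2 - v ^ 2) =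
      ((a - b) * (u + v)) * ((u - v) * (a + b)) := by ring
    have e2 : (a - b) ^ 2 * (u + v) ^ 2 ≤ (a - b) ^ 2 * (2 * (u ^ 2 + v ^ 2)) := by
      gcongr; nlinarith [sq_nonneg (u - v)]
    have e3 : (u - v) ^ 2 * (a + b) ^ 2 ≤ (u - v) ^ 2 * (2 * (a ^ 2 + b ^ 2)) := by
      gcongr; nlinarith [sq_nonneg (a - b)]
    rw [e1, abs_le]
    constructor
    · nlinarith [sq_nonneg ((a - b) * (u + v) + (u - v) * (a + b))]
    · nlinarith [sq_nonneg ((a - b) * (u + v) - (u - v) * (a + b))]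
  calc _ ≤ (|a ^ 2 - b ^ 2| + E₁) * (|u ^ 2 - v ^ 2| + E₂) := by gcongr
    _ = |a ^ 2 - b ^ 2| * |u ^ 2 - v ^ 2| + (|a ^ 2 - b ^ 2| + E₁) * E₂
        + E₁ * |u ^ 2 - v ^ 2| := by ring
    _ ≤ _ := by gcongr

lemma half_pow {κ s u : ℝ} (hκ : 0 < κ) (hu : 0 < u) (h : u / 2 ≤ s) :
    (1 + s) ^ (-κ / 2) ≤ 2 ^ (κ / 2) * (1 + u) ^ (-κ / 2) := by
  have h2 : (2 : ℝ) ^ (κ / 2) = (1 / 2) ^ (-κ / 2) := by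
    rw [neg_div, one_div, Real.inv_rpow (by norm_num), Real.rpow_neg (by norm_num), inv_inv]
  rw [h2, ← Real.mul_rpow (by norm_num) (by linarith)]
  exact Real.rpow_le_rpow_of_nonpos (by linarith) (by linarith) (by linarith)

set_option maxHeartbeats 1000000 in
lemma half_bound (d : ℕ) (hd : 3 ≤ d) (κ : ℝ) (hκ : 2 < κ ∧ κ < d) (C : ℝ) (hC : 0 ≤ C) :
    ∃ K > 0, ∀ R : EuclideanSpace ℝ (Fin d) → ℝ, (∀ x, 0 ≤ R x) →
      (∀ x, R x ≤ C * (1 + ‖x‖) ^ (-κ)) → ∀ t r : ℝ, 0 < r → r ≤ t / 2 →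
      ∀ x : EuclideanSpace ℝ (Fin d),
      (∫ z₁, ∫ z₂, |Hker d t x r z₁| * |Hker d t x r z₂| * R (z₁ - z₂)) ≤
        K * (r / t * (1 + ‖x‖ ^ 2 / t) * (1 + r) ^ (-κ / 2) + (1 + t) ^ (-κ / 2)) := by
  obtain ⟨K, hK, hconv⟩ := conv_bound d hd κ hκ
  have hκ0 : 0 < κ := by linarith [hκ.1]
  set L : ℝ := 2 * K * 2 ^ (κ / 2) with hL
  have hL0 : 0 < L := by positivity
  refine ⟨C * (4 * d + 5) * L + 1, by positivity, ?_⟩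
  intro R hR0 hR t r hr hrt x
  have ht : 0 < t := by linarith
  have htr : 0 < t - r := by linarith
  have hs : 0 < r * (t - r) / t := by positivity
  have hs2 : r / 2 ≤ r * (t - r) / t := by
    rw [le_div_iff₀ ht]; nlinarith
  set s := r * (t - r) / t with hsdef
  set ρ : EuclideanSpace ℝ (Fin d) → EuclideanSpace ℝ (Fin d) → ENNReal :=
    fun z₁ z₂ => ENNReal.ofReal ((1 + ‖z₁ - z₂‖) ^ (-κ)) with hρ
  set A : EuclideanSpace ℝ (Fin d) → ℝ := fun z => heatKernel d s (z + (r / t) • x) with hA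
  set B : EuclideanSpace ℝ (Fin d) → ℝ := fun z => heatKernel d r z with hB
  set E : EuclideanSpace ℝ (Fin d) → ℝ := fun z => heatKernel d (t - r) (z + x) with hE
  have hA0 : ∀ z, 0 ≤ A z := fun z => hk_nonneg d hs _
  have hB0 : ∀ z, 0 ≤ B z := fun z => hk_nonneg d hr _
  have hE0 : ∀ z, 0 ≤ E z := fun z => hk_nonneg d htr _
  have hAc : Continuous A := (hk_cont d s).comp (by fun_prop)
  have hBc : Continuous B := hk_cont d r
  have hEc : Continuous E := (hk_cont d (t - r)).comp (by fun_prop)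
  have hρm : Measurable (Function.uncurry ρ) := by
    apply Measurable.ennreal_ofReal
    fun_prop
  have hρz : ∀ z₁, Measurable (fun z₂ => ρ z₁ z₂) := by
    intro z₁
    apply Measurable.ennreal_ofReal
    fun_prop
  set a : EuclideanSpace ℝ (Fin d) → ENNReal := fun z => ENNReal.ofReal ((√(A z) - √(B z)) ^ 2)
    with ha
  set S : EuclideanSpace ℝ (Fin d) → ENNReal := fun z => ENNReal.ofReal (A z + B z) with hS
  set e : EuclideanSpace ℝ (Fin d) → ENNReal := fun z => ENNReal.ofReal (E z) with he
  have ham : Measurable a := by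
    apply Measurable.ennreal_ofReal; exact Continuous.measurable (by fun_prop)
  have hSm : Measurable S := by
    apply Measurable.ennreal_ofReal; exact Continuous.measurable (by fun_prop)
  have hem : Measurable e := by
    apply Measurable.ennreal_ofReal; exact Continuous.measurable (by fun_prop)
  have hAm : Measurable (fun z => ENNReal.ofReal (A z)) := by
    apply Measurable.ennreal_ofReal; exact Continuous.measurable (by fun_prop)
  have hSeq : ∀ z, S z = ENNReal.ofReal (A z) + ENNReal.ofReal (B z) := fun z =>
    ENNReal.ofReal_add (hA0 z) (hB0 z)
  have hSint : ∫⁻ z, S z = ENNReal.ofReal 2 := by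
    simp_rw [hSeq]
    rw [lintegral_add_left hAm, hk_lint d hs]
    have := hk_lint d hr 0
    simp only [add_zero] at this
    rw [this, ← ENNReal.ofReal_one, ← ENNReal.ofReal_add (by norm_num) (by norm_num)]
    norm_num
  have heint : ∫⁻ z, e z = ENNReal.ofReal 1 := by
    rw [ENNReal.ofReal_one]; exact hk_lint d htr x
  have haint : ∫⁻ z, a z ≤ ENNReal.ofReal (2 * d * (r / t * (1 + ‖x‖ ^ 2 / t))) :=
    hell_bridge d hd hr hrt x
  have hMe : ∀ z₁, ∫⁻ z₂, e z₂ * ρ z₁ z₂ ≤ ENNReal.ofReal (L * (1 + t) ^ (-κ / 2)) := by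
    intro z₁
    refine (hconv (t - r) htr x z₁).trans (ENNReal.ofReal_le_ofReal ?_)
    have h1 := half_pow (κ := κ) (s := t - r) (u := t) hκ0 ht (by linarith)
    calc K * (1 + (t - r)) ^ (-κ / 2) ≤ K * (2 ^ (κ / 2) * (1 + t) ^ (-κ / 2)) := by gcongr
      _ = K * 2 ^ (κ / 2) * (1 + t) ^ (-κ / 2) := by ring
      _ ≤ _ := by
        gcongr
        rw [hL]
        gcongr
        linarith
  have hMS : ∀ z₁, ∫⁻ z₂, S z₂ * ρ z₁ z₂ ≤ ENNReal.ofReal (L * (1 + r) ^ (-κ / 2)) := by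
    intro z₁
    simp_rw [hSeq, add_mul]
    have hAρ : Measurable (fun z₂ => ENNReal.ofReal (A z₂) * ρ z₁ z₂) :=
      hAm.mul (hρz z₁)
    rw [lintegral_add_left hAρ]
    have h1 := hconv s hs ((r / t) • x) z₁
    have h2 := hconv r hr 0 z₁
    simp only [add_zero] at h2
    refine (add_le_add h1 h2).trans ?_
    rw [← ENNReal.ofReal_add (by positivity) (by positivity)]
    apply ENNReal.ofReal_le_ofReal
    have h3 := half_pow (κ := κ) (s := s) (u := r) hκ0 hr hs2
    have h4 := half_pow (κ := κ) (s := r) (u := r) hκ0 hr (by linarith)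
    calc _ ≤ K * (2 ^ (κ / 2) * (1 + r) ^ (-κ / 2)) + K * (2 ^ (κ / 2) * (1 + r) ^ (-κ / 2)) := by
          gcongr
      _ = _ := by rw [hL]; ring
  have hq := quad_bound volume ρ a S e ham hSm hem hρm
    (fun z w => by simp only [hρ]; rw [norm_sub_rev]) _ _ hMS hMe
  have hpt : ∀ z₁ z₂, ‖|Hker d t x r z₁| * |Hker d t x r z₂| * R (z₁ - z₂)‖ₑ ≤
      ENNReal.ofReal C *
      ((a z₁ * S z₂ + S z₁ * a z₂ + (S z₁ + e z₁) * e z₂ + e z₁ * S z₂) * ρ z₁ z₂) := by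
    intro z₁ z₂
    have h1 := pw_bound (hA0 z₁) (hB0 z₁) (hE0 z₁) (hA0 z₂) (hB0 z₂) (hE0 z₂)
    have hS0 : ∀ z, 0 ≤ A z + B z := fun z => add_nonneg (hA0 z) (hB0 z)
    have hSE0 : ∀ z, 0 ≤ A z + B z + E z := fun z => add_nonneg (hS0 z) (hE0 z)
    have hq0 : ∀ z, 0 ≤ (√(A z) - √(B z)) ^ 2 := fun z => sq_nonneg _
    have e1 : a z₁ * S z₂ + S z₁ * a z₂ + (S z₁ + e z₁) * e z₂ + e z₁ * S z₂ =
        ENNReal.ofReal ((√(A z₁) - √(B z₁)) ^ 2 * (A z₂ + B z₂)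
          + (A z₁ + B z₁) * (√(A z₂) - √(B z₂)) ^ 2
          + (A z₁ + B z₁ + E z₁) * E z₂ + E z₁ * (A z₂ + B z₂)) := by
      have k1 := mul_nonneg (hq0 z₁) (hS0 z₂)
      have k2 := mul_nonneg (hS0 z₁) (hq0 z₂)
      have k3 := mul_nonneg (hSE0 z₁) (hE0 z₂)
      have k4 := mul_nonneg (hE0 z₁) (hS0 z₂)
      rw [ENNReal.ofReal_add (add_nonneg (add_nonneg k1 k2) k3) k4,
        ENNReal.ofReal_add (add_nonneg k1 k2) k3, ENNReal.ofReal_add k1 k2,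
        ENNReal.ofReal_mul (hq0 z₁), ENNReal.ofReal_mul (hS0 z₁), ENNReal.ofReal_mul (hSE0 z₁),
        ENNReal.ofReal_mul (hE0 z₁), ENNReal.ofReal_add (hS0 z₁) (hE0 z₁)]
    have hρ0 : 0 ≤ (1 + ‖z₁ - z₂‖) ^ (-κ) := by positivity
    rw [e1, Real.enorm_of_nonneg (mul_nonneg (by positivity) (hR0 _)), hρ,
      ← ENNReal.ofReal_mul (le_trans (by positivity) h1), ← ENNReal.ofReal_mul hC]
    apply ENNReal.ofReal_le_ofReal
    have h2 := hR (z₁ - z₂)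
    have h3 := hR0 (z₁ - z₂)
    calc _ ≤ ((√(A z₁) - √(B z₁)) ^ 2 * (A z₂ + B z₂)
          + (A z₁ + B z₁) * (√(A z₂) - √(B z₂)) ^ 2
          + (A z₁ + B z₁ + E z₁) * E z₂ + E z₁ * (A z₂ + B z₂)) *
          (C * (1 + ‖z₁ - z₂‖) ^ (-κ)) :=
          mul_le_mul h1 h2 h3 (le_trans (by positivity) h1)
      _ = _ := by ring
  have hmain : ‖∫ z₁, ∫ z₂, |Hker d t x r z₁| * |Hker d t x r z₂| * R (z₁ - z₂)‖ₑ ≤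
      ENNReal.ofReal (C * (2 * (2 * d * (r / t * (1 + ‖x‖ ^ 2 / t))) * (L * (1 + r) ^ (-κ / 2))
        + 5 * (L * (1 + t) ^ (-κ / 2)))) := by
    calc _ ≤ ∫⁻ z₁, ‖∫ z₂, |Hker d t x r z₁| * |Hker d t x r z₂| * R (z₁ - z₂)‖ₑ :=
          enorm_integral_le_lintegral_enorm _
      _ ≤ ∫⁻ z₁, ∫⁻ z₂, ‖|Hker d t x r z₁| * |Hker d t x r z₂| * R (z₁ - z₂)‖ₑ :=
          lintegral_mono fun z₁ => enorm_integral_le_lintegral_enorm _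
      _ ≤ ∫⁻ z₁, ∫⁻ z₂, ENNReal.ofReal C *
      ((a z₁ * S z₂ + S z₁ * a z₂ + (S z₁ + e z₁) * e z₂ + e z₁ * S z₂) * ρ z₁ z₂) :=
          lintegral_mono fun z₁ => lintegral_mono fun z₂ => hpt z₁ z₂
      _ = ENNReal.ofReal C * ∫⁻ z₁, ∫⁻ z₂,
      ((a z₁ * S z₂ + S z₁ * a z₂ + (S z₁ + e z₁) * e z₂ + e z₁ * S z₂) * ρ z₁ z₂) := by
          simp_rw [lintegral_const_mul' _ _ ENNReal.ofReal_ne_top]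
      _ ≤ _ := by
          rw [ENNReal.ofReal_mul hC]
          gcongr
          refine hq.trans ?_
          rw [hSint, heint]
          have p1 : 0 ≤ L * (1 + r) ^ (-κ / 2) := by positivity
          have p2 : 0 ≤ L * (1 + t) ^ (-κ / 2) := by positivity
          have p3 : 0 ≤ 2 * d * (r / t * (1 + ‖x‖ ^ 2 / t)) := by positivity
          calc _ ≤ ENNReal.ofReal (2 * d * (r / t * (1 + ‖x‖ ^ 2 / t))) *
                ENNReal.ofReal (L * (1 + r) ^ (-κ / 2))
              + ENNReal.ofReal (2 * d * (r / t * (1 + ‖x‖ ^ 2 / t))) *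
                ENNReal.ofReal (L * (1 + r) ^ (-κ / 2))
              + (ENNReal.ofReal 2 + ENNReal.ofReal 1) * ENNReal.ofReal (L * (1 + t) ^ (-κ / 2))
              + ENNReal.ofReal 2 * ENNReal.ofReal (L * (1 + t) ^ (-κ / 2)) := by gcongr
            _ = _ := by
              rw [← ENNReal.ofReal_mul p3, ← ENNReal.ofReal_add (show (0 : ℝ) ≤ 2 by norm_num)
                  (show (0 : ℝ) ≤ 1 by norm_num),
                ← ENNReal.ofReal_mul (show (0 : ℝ) ≤ 2 + 1 by norm_num),
                ← ENNReal.ofReal_mul (show (0 : ℝ) ≤ 2 by norm_num),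
                ← ENNReal.ofReal_add (by positivity) (by positivity),
                ← ENNReal.ofReal_add (by positivity) (by positivity),
                ← ENNReal.ofReal_add (by positivity) (by positivity)]
              congr 1
              ring
  have hI0 : 0 ≤ ∫ z₁, ∫ z₂, |Hker d t x r z₁| * |Hker d t x r z₂| * R (z₁ - z₂) :=
    integral_nonneg fun z₁ => integral_nonneg fun z₂ => mul_nonneg (by positivity) (hR0 _)
  rw [Real.enorm_of_nonneg hI0, ENNReal.ofReal_le_ofReal_iff (by positivity)] at hmain
  refine hmain.trans ?_
  set P := r / t * (1 + ‖x‖ ^ 2 / t) * (1 + r) ^ (-κ / 2) with hP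
  set Q := (1 + t) ^ (-κ / 2) with hQ
  have hP0 : 0 ≤ P := by positivity
  have hQ0 : 0 ≤ Q := by positivity
  have hCL : 0 ≤ C * L := by positivity
  have e2 : C * (2 * (2 * d * (r / t * (1 + ‖x‖ ^ 2 / t))) * (L * (1 + r) ^ (-κ / 2))
        + 5 * (L * Q)) = C * L * (4 * d) * P + C * L * 5 * Q := by rw [hP]; ring
  rw [e2]
  have : 0 ≤ C * L * 5 * P := by positivity
  have : 0 ≤ C * L * (4 * d) * Q := by positivity
  nlinarith

lemma Hker_symm (d : ℕ) {t : ℝ} (ht : 0 < t) (x : EuclideanSpace ℝ (Fin d)) (r : ℝ)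
    (z : EuclideanSpace ℝ (Fin d)) : Hker d t x r (-x - z) = Hker d t x (t - r) z := by
  unfold Hker
  have e1 : -x - z + (r / t) • x = -(z + ((t - r) / t) • x) := by
    have : (t - r) / t = 1 - r / t := by field_simp
    rw [this, sub_smul, one_smul]; abel
  have e2 : -x - z = -(z + x) := by abel
  have e3 : -x - z + x = - z := by abel
  rw [e1, e3, e2, hk_neg, hk_neg, hk_neg]
  have : t - (t - r) = r := by ring
  rw [this, mul_comm r (t - r)]
  ring

lemma F_symm (d : ℕ) {t : ℝ} (ht : 0 < t) (x : EuclideanSpace ℝ (Fin d)) (r : ℝ)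
    (R : EuclideanSpace ℝ (Fin d) → ℝ) :
    (∫ z₁, ∫ z₂, |Hker d t x r z₁| * |Hker d t x r z₂| * R (z₁ - z₂)) =
    ∫ z₁, ∫ z₂, |Hker d t x (t - r) z₁| * |Hker d t x (t - r) z₂| * R (-(z₁ - z₂)) := by
  rw [← integral_sub_left_eq_self _ volume (-x)]
  congr 1
  funext z₁
  rw [← integral_sub_left_eq_self _ volume (-x)]
  congr 1
  funext z₂
  rw [Hker_symm d ht, Hker_symm d ht]
  congr 2
  abel

lemma real_step {κ t r y : ℝ} (hκ : 2 < κ) (hr : 0 < r) (hrt : r < t) (hy : 0 ≤ y) :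
    r / t * (1 + y / t) * (1 + r) ^ (-κ / 2) + (1 + t) ^ (-κ / 2) ≤
      (1 / t * (1 + r) ^ (-(1 - 2 / κ)) + (1 + t) ^ (-(1 - 2 / κ)) * (1 / t))
        * (1 + (1 + t)⁻¹ * y) := by
  have ht : 0 < t := by linarith
  have hμ : -κ / 2 ≤ -1 + -(1 - 2 / κ) := by
    have : 2 / κ * κ = 2 := by field_simp
    have h : 0 < 2 / κ := by positivity
    have : 2 - 2 / κ ≤ κ / 2 := by
      have : κ / 2 + 2 / κ - 2 = (κ - 2) ^ 2 / (2 * κ) := by field_simp; ring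
      have : 0 ≤ (κ - 2) ^ 2 / (2 * κ) := by positivity
      linarith
    linarith
  have hpow : ∀ u : ℝ, 0 < u → (1 + u) ^ (-κ / 2) ≤ (1 + u)⁻¹ * (1 + u) ^ (-(1 - 2 / κ)) := by
    intro u hu
    rw [← Real.rpow_neg_one, ← Real.rpow_add (by linarith)]
    exact Real.rpow_le_rpow_of_exponent_le (by linarith) hμ
  have hr1 := hpow r hr
  have ht1 := hpow t ht
  set p := (1 + r) ^ (-(1 - 2 / κ)) with hp
  set q := (1 + t) ^ (-(1 - 2 / κ)) with hq
  have hp0 : 0 < p := by positivity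
  have hq0 : 0 < q := by positivity
  have h1 : r / t * (1 + y / t) * (1 + r)⁻¹ ≤ 1 / t * (1 + (1 + t)⁻¹ * y) := by
    have h2 : 1 + y / t ≤ (1 + t) / t * (1 + (1 + t)⁻¹ * y) := by
      have : (1 + t) / t * (1 + (1 + t)⁻¹ * y) = 1 + y / t + 1 / t := by field_simp; ring
      rw [this]
      have : 0 < 1 / t := by positivity
      linarith
    have h3 : r / t * ((1 + t) / t) * (1 + r)⁻¹ ≤ 1 / t := by
      have : r / t * ((1 + t) / t) * (1 + r)⁻¹ = 1 / t * (r * (1 + t) / (t * (1 + r))) := by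
        field_simp
      rw [this]
      apply mul_le_of_le_one_right (by positivity)
      rw [div_le_one (by positivity)]
      nlinarith
    calc _ ≤ r / t * ((1 + t) / t * (1 + (1 + t)⁻¹ * y)) * (1 + r)⁻¹ := by gcongr
      _ = r / t * ((1 + t) / t) * (1 + r)⁻¹ * (1 + (1 + t)⁻¹ * y) := by ring
      _ ≤ _ := by gcongr
  have hX : 1 ≤ 1 + (1 + t)⁻¹ * y := by
    have : 0 ≤ (1 + t)⁻¹ * y := by positivity
    linarith
  have h4 : (1 + t)⁻¹ ≤ 1 / t := by
    rw [one_div]; gcongr; linarith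
  calc _ ≤ r / t * (1 + y / t) * ((1 + r)⁻¹ * p) + (1 / t * q) * 1 := by
        gcongr
        rw [mul_one]
        refine ht1.trans ?_
        gcongr
    _ = r / t * (1 + y / t) * (1 + r)⁻¹ * p + (1 / t * q) * 1 := by ring
    _ ≤ 1 / t * (1 + (1 + t)⁻¹ * y) * p + (1 / t * q) * (1 + (1 + t)⁻¹ * y) := by gcongr
    _ = _ := by ring

lemma int_step {m t : ℝ} (hm0 : 0 < m) (hm : m < 1) (ht : 0 < t) :
    IntervalIntegrable (fun r : ℝ => (1 + r) ^ (-m)) volume 0 t ∧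
    ∫ r in (0 : ℝ)..t, (1 + r) ^ (-m) ≤ t * (1 + t) ^ (-m) / (1 - m) := by
  constructor
  · apply ContinuousOn.intervalIntegrable
    rw [uIcc_of_le ht.le]
    intro r hr
    apply ContinuousAt.continuousWithinAt
    apply ContinuousAt.rpow_const (by fun_prop)
    left
    linarith [hr.1]
  · rw [intervalIntegral.integral_comp_add_left (fun r : ℝ => r ^ (-m)),
      integral_rpow (Or.inl (by linarith))]
    have e1 : -m + 1 = 1 - m := by ring
    rw [e1, add_zero, Real.one_rpow]
    have h0 : (0 : ℝ) < 1 - m := by linarith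
    gcongr
    have e2 : (1 + t) ^ (1 - m) = (1 + t) * (1 + t) ^ (-m) := by
      rw [sub_eq_add_neg, Real.rpow_add (by linarith), Real.rpow_one]
    have e3 : (1 + t) ^ (-m) ≤ 1 :=
      Real.rpow_le_one_of_one_le_of_nonpos (by linarith) (by linarith)
    rw [e2]
    linarith

theorem stmt15 (d : ℕ) (hd : 3 ≤ d) (κ : ℝ) (hκ : 2 < κ ∧ κ < d)
    (R : EuclideanSpace ℝ (Fin d) → ℝ) (C : ℝ)
    (hRnonneg : ∀ x, 0 ≤ R x) (hR : ∀ x, R x ≤ C * (1 + ‖x‖) ^ (-κ)) :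
    ∃ C' > 0, ∀ t > (0 : ℝ), ∀ x : EuclideanSpace ℝ (Fin d),
      (∫ r in Set.Ioo (0 : ℝ) t, ∫ z₁, ∫ z₂,
          |Hker d t x r z₁| * |Hker d t x r z₂| * R (z₁ - z₂))
        ≤ C' * (1 + t) ^ (-(1 - 2 / κ)) * (1 + (1 + t)⁻¹ * ‖x‖ ^ 2) := by
  have hC : 0 ≤ C := by
    have h1 := hRnonneg 0
    have h2 := hR 0
    simp at h2
    linarith
  obtain ⟨K, hK, hhalf⟩ := half_bound d hd κ hκ C hC
  have hκ0 : 0 < κ := by linarith [hκ.1]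
  set m : ℝ := 1 - 2 / κ with hm
  have hm0 : 0 < m := by
    have : 2 / κ < 1 := by rw [div_lt_one hκ0]; exact hκ.1
    linarith
  have hm1 : m < 1 := by
    have : 0 < 2 / κ := by positivity
    linarith
  have h1m : 0 < 1 - m := by linarith
  refine ⟨2 * K * (1 / (1 - m) + 1), by positivity, ?_⟩
  intro t ht x
  set X : ℝ := 1 + (1 + t)⁻¹ * ‖x‖ ^ 2 with hX
  have hX0 : 0 < X := by positivity
  set q : ℝ := (1 + t) ^ (-m) with hq
  have hq0 : 0 < q := by positivity
  set G : ℝ → ℝ := fun r => K * X * (1 / t * (1 + r) ^ (-m) + q * (1 / t)) with hG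
  have hGnn : ∀ r, 0 < r → 0 ≤ G r := by
    intro r hr
    simp only [hG]
    positivity
  have key : ∀ r ∈ Ioo 0 t, (∫ z₁, ∫ z₂, |Hker d t x r z₁| * |Hker d t x r z₂| * R (z₁ - z₂))
      ≤ G r + G (t - r) := by
    intro r hr
    have hr' : 0 < t - r := by linarith [hr.2]
    have hcase : ∀ R' : EuclideanSpace ℝ (Fin d) → ℝ, (∀ x, 0 ≤ R' x) →
        (∀ x, R' x ≤ C * (1 + ‖x‖) ^ (-κ)) → ∀ r, 0 < r → r ≤ t / 2 →
        (∫ z₁, ∫ z₂, |Hker d t x r z₁| * |Hker d t x r z₂| * R' (z₁ - z₂)) ≤ G r := by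
      intro R' h0 h1 r hr hrt
      refine (hhalf R' h0 h1 t r hr hrt x).trans ?_
      have := real_step (t := t) (y := ‖x‖ ^ 2) hκ.1 hr (by linarith) (by positivity)
      calc _ ≤ K * ((1 / t * (1 + r) ^ (-m) + q * (1 / t)) * X) := by gcongr
        _ = _ := by simp only [hG]; ring
    rcases le_total r (t / 2) with h | h
    · have := hcase R hRnonneg hR r hr.1 h
      linarith [hGnn _ hr']
    · rw [F_symm d ht x r R]
      have := hcase (fun w => R (-w)) (fun w => hRnonneg _)
        (fun w => by have := hR (-w); rwa [norm_neg] at this) (t - r) hr' (by linarith)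
      linarith [hGnn _ hr.1]
  obtain ⟨hii, hint⟩ := int_step hm0 hm1 ht
  have hGi : IntervalIntegrable G volume 0 t :=
    ((hii.const_mul (1 / t)).add intervalIntegrable_const).const_mul (K * X)
  have hGi2 : IntervalIntegrable (fun r => G (t - r)) volume 0 t := by
    have := (hGi.comp_sub_left t).symm
    simpa using this
  have hGint : ∫ r in (0 : ℝ)..t, G r ≤ K * X * (q * (1 / (1 - m) + 1)) := by
    simp only [hG]
    rw [intervalIntegral.integral_const_mul, intervalIntegral.integral_add (hii.const_mul (1 / t))
      intervalIntegrable_const, intervalIntegral.integral_const_mul,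
      intervalIntegral.integral_const]
    have e1 : (t - 0) • (q * (1 / t)) = q := by
      rw [smul_eq_mul]; field_simp; ring
    rw [e1]
    have e2 : 1 / t * (∫ r in (0 : ℝ)..t, (1 + r) ^ (-m)) ≤ 1 / t * (t * q / (1 - m)) := by
      gcongr
    have e3 : 1 / t * (t * q / (1 - m)) = q * (1 / (1 - m)) := by field_simp
    have : 1 / t * (∫ r in (0 : ℝ)..t, (1 + r) ^ (-m)) + q ≤ q * (1 / (1 - m) + 1) := by
      linarith
    gcongr
  have hfin : ∫ r in (0 : ℝ)..t, (G r + G (t - r)) ≤ 2 * (K * X * (q * (1 / (1 - m) + 1))) := by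
    rw [intervalIntegral.integral_add hGi hGi2, intervalIntegral.integral_comp_sub_left]
    simp only [sub_self, sub_zero]
    linarith
  have hmono : (∫ r in Ioo (0 : ℝ) t, ∫ z₁, ∫ z₂,
      |Hker d t x r z₁| * |Hker d t x r z₂| * R (z₁ - z₂)) ≤
      ∫ r in Ioo (0 : ℝ) t, (G r + G (t - r)) := by
    apply integral_mono_of_nonneg
    · exact Filter.Eventually.of_forall fun r => integral_nonneg fun z₁ =>
        integral_nonneg fun z₂ => mul_nonneg (by positivity) (hRnonneg _)
    · have := hGi.add hGi2
      rwa [intervalIntegrable_iff_integrableOn_Ioo_of_le ht.le] at this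
    · filter_upwards [ae_restrict_mem measurableSet_Ioo] with r hr
      exact key r hr
  rw [intervalIntegral.integral_of_le ht.le, integral_Ioc_eq_integral_Ioo] at hfin
  calc _ ≤ _ := hmono
    _ ≤ _ := hfin
    _ = _ := by ring
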